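/- Let A be a rigid domain of finite transcendence degree over a field k of characteristic zero, i.e. the zero derivation is the only locally nilpotent k-derivation of A. Then the polynomial ring A[x] in one variable over A is a semi-rigid k-domain. -/

import Mathlib

variable {k A : Type*}

/-- A locally nilpotent `k`-derivation. -/
def IsLND [CommRing k] [CommRing A] [Algebra k A] (D : Derivation k A A) : Prop :=
  ∀ a : A, ∃ n : ℕ, ((D.toLinearMap : Module.End k A) ^ n) a = 0

/-- A `k`-domain is semi-rigid if all of its nonzero locally nilpotent derivations induce
the same filtration by kernels of powers. -/
def SemiRigid (k B : Type*) [CommRing k] [CommRing B] [Algebra k B] : Prop :=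
  ∀ (D E : Derivation k B B), IsLND D → IsLND E → D ≠ 0 → E ≠ 0 →
    ∀ i : ℕ, LinearMap.ker ((D.toLinearMap : Module.End k B) ^ (i + 1)) =
      LinearMap.ker ((E.toLinearMap : Module.End k B) ^ (i + 1))

section LocallyNilpotent

theorem isLND_iff_iterate [CommRing k] [CommRing A] [Algebra k A] {D : Derivation k A A} :
    IsLND D ↔ ∀ a, ∃ n : ℕ, D^[n] a = 0 := by
  simp only [IsLND, Module.End.pow_apply]
  rfl

theorem Derivation.iterate_mul_of_iterate_succ_eq_zero [CommRing k] [CommRing A] [Algebra k A]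
    (D : Derivation k A A) (n m : ℕ) {a b : A} (ha : D^[n + 1] a = 0) (hb : D^[m + 1] b = 0) :
    D^[n + m] (a * b) = ((n + m).choose n : A) * (D^[n] a * D^[m] b) := by
  induction n generalizing m a b with
  | zero =>
    have ha' : D a = 0 := ha
    have key : ∀ j, D^[j] (a * b) = a * D^[j] b := by
      intro j
      induction j with
      | zero => rfl
      | succ j ih => simp [Function.iterate_succ_apply', ih, ha']
    simp [key]
  | succ n ihn =>
    induction m generalizing a b with
    | zero =>
      have hb' : D b = 0 := hb
      have key : ∀ j, D^[j] (a * b) = D^[j] a * b := by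
        intro j
        induction j with
        | zero => rfl
        | succ j ih => simp [Function.iterate_succ_apply', ih, hb', mul_comm]
      simp [key]
    | succ m ihm =>
      have h1 := ihn (m + 1) (a := D a) (b := b) ha hb
      have h2 := ihm (a := a) (b := D b) ha hb
      have h3 : D (a * b) = D a * b + a * D b := by
        rw [D.leibniz, smul_eq_mul, smul_eq_mul]; ring
      rw [show n + 1 + (m + 1) = (n + (m + 1)) + 1 by ring, Function.iterate_succ_apply, h3,
        iterate_map_add, h1, show n + (m + 1) = n + 1 + m by ring, h2, Nat.choose_succ_succ,
        Function.iterate_succ_apply]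
      push_cast
      rw [Function.iterate_succ_apply]
      ring

theorem IsLND.exists_iterate_ne_zero [CommRing k] [CommRing A] [Algebra k A]
    {D : Derivation k A A} (hD : IsLND D) {a : A} (ha : a ≠ 0) :
    ∃ n : ℕ, D^[n] a ≠ 0 ∧ D^[n + 1] a = 0 := by
  classical
  have h := isLND_iff_iterate.1 hD a
  rcases hn : Nat.find h with _ | n
  · have := Nat.find_spec h
    rw [hn] at this
    exact absurd this ha
  · refine ⟨n, Nat.find_min h (by omega), ?_⟩
    have := Nat.find_spec h
    rwa [hn] at this

theorem IsLND.apply_eq_zero_of_dvd [CommRing k] [CommRing A] [IsDomain A] [CharZero A]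
    [Algebra k A] {D : Derivation k A A} (hD : IsLND D) {a : A} (h : a ∣ D a) : D a = 0 := by
  obtain ⟨b, hb⟩ := h
  by_contra hne
  have ha : a ≠ 0 := by rintro rfl; simp at hne
  have hb0 : b ≠ 0 := by rintro rfl; simp [hb] at hne
  obtain ⟨n, hn, hn'⟩ := hD.exists_iterate_ne_zero ha
  obtain ⟨m, hm, hm'⟩ := hD.exists_iterate_ne_zero hb0
  have h1 := D.iterate_mul_of_iterate_succ_eq_zero n m hn' hm'
  rw [← hb, ← Function.iterate_succ_apply, show (n + m).succ = m + (n + 1) by omega,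
    Function.iterate_add_apply, hn', iterate_map_zero] at h1
  have h2 : ((n + m).choose n : A) ≠ 0 :=
    Nat.cast_ne_zero.2 (Nat.choose_pos (Nat.le_add_right n m)).ne'
  exact mul_ne_zero h2 (mul_ne_zero hn hm) h1.symm

theorem Derivation.eq_zero_of_isAlgebraic [CommRing k] [CommRing A] [IsDomain A] [CharZero A]
    [Algebra k A] [FaithfulSMul k A] [Algebra.IsAlgebraic k A] (D : Derivation k A A) : D = 0 := by
  ext a
  have key : ∀ n, ∀ p : Polynomial k, p.natDegree ≤ n → p ≠ 0 → p.aeval a = 0 → D a = 0 := by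
    have hinj := FaithfulSMul.algebraMap_injective k A
    have : CharZero k := ⟨fun m n h => by
      simpa using congrArg (algebraMap k A) h⟩
    have : IsDomain k := hinj.isDomain
    intro n
    induction n with
    | zero =>
      intro p hp hp0 hpa
      rw [Polynomial.eq_C_of_natDegree_le_zero hp, Polynomial.aeval_C,
        map_eq_zero_iff _ hinj] at hpa
      rw [Polynomial.eq_C_of_natDegree_le_zero hp, hpa] at hp0
      simp at hp0
    | succ n ih =>
      intro p hp hp0 hpa
      have h := D.map_aeval p a
      rw [hpa, map_zero, smul_eq_mul, eq_comm, mul_eq_zero] at h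
      refine h.elim (fun h => ?_) id
      by_cases hd : p.derivative = 0
      · exact ih p (by rw [Polynomial.derivative_eq_zero.1 hd]; omega) hp0 hpa
      · exact ih _ ((Polynomial.natDegree_derivative_le p).trans (by omega)) hd h
  obtain ⟨p, hp0, hpa⟩ := Algebra.IsAlgebraic.isAlgebraic (R := k) a
  exact key _ p le_rfl hp0 hpa

end LocallyNilpotent

namespace Polynomial

variable [CommRing k] [CommRing A] [Algebra k A]

/-- The derivation of `A` sending `a` to the coefficient of `X ^ j` in `D a`. -/
noncomputable def coeffDerivation (D : Derivation k A[X] A[X]) (j : ℕ) : Derivation k A A :=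
  Derivation.mk' ((lcoeff A j).restrictScalars k ∘ₗ D.toLinearMap ∘ₗ (CAlgHom (R := k)).toLinearMap)
    fun a b => by simp

@[simp]
theorem coeffDerivation_apply (D : Derivation k A[X] A[X]) (j : ℕ) (a : A) :
    coeffDerivation D j a = (D (C a)).coeff j := rfl

/-- The homogeneous derivation of `A[X]` of degree `d` given by `a ↦ δ a * X ^ d` on `A` and by
`X ↦ f * X ^ (d + 1)`. -/
noncomputable def homogeneousDerivation (δ : Derivation k A A) (f : A) (d : ℕ) :
    Derivation k A[X] A[X] :=
  (X ^ d : A[X]) •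
      (PolynomialModule.equivPolynomialSelf (R := A)).toLinearMap.compDer δ.mapCoeffs +
    (C f * X ^ (d + 1)) • (derivative' (R := A)).restrictScalars k

theorem homogeneousDerivation_monomial (δ : Derivation k A A) (f : A) (d n : ℕ) (a : A) :
    homogeneousDerivation δ f d (monomial n a) = monomial (n + d) (δ a + n * f * a) := by
  have h1 : PolynomialModule.equivPolynomialSelf (δ.mapCoeffs (monomial n a)) =
      monomial n (δ a) := by
    rw [Derivation.mapCoeffs_monomial]
    rfl
  have h2 : homogeneousDerivation δ f d (monomial n a) =
      X ^ d * PolynomialModule.equivPolynomialSelf (δ.mapCoeffs (monomial n a)) +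
        C f * X ^ (d + 1) * derivative (monomial n a) := rfl
  rw [h2, h1, derivative_monomial, map_add, X_pow_mul_monomial, mul_assoc, X_pow_mul_monomial,
    C_mul_monomial]
  cases n with
  | zero => simp
  | succ n =>
    rw [show n + 1 - 1 + (d + 1) = n + 1 + d by omega]
    congr 2
    ring

/-- `D` raises degrees in `X` by less than `d`. -/
def RaisesDegreeLT (D : Derivation k A[X] A[X]) (d : ℕ) : Prop :=
  ∀ j, d ≤ j → (∀ a, (D (C a)).coeff j = 0) ∧ (D X).coeff (j + 1) = 0

theorem RaisesDegreeLT.coeff_eq_zero {D : Derivation k A[X] A[X]} {d : ℕ}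
    (hD : RaisesDegreeLT D d) {n : ℕ} {q : A[X]} (hq : q.natDegree ≤ n) {j : ℕ}
    (hj : n + d ≤ j) : (D q).coeff j = 0 := by
  refine induction_with_natDegree_le (fun q => (D q).coeff j = 0) n (by simp) ?_ ?_ q hq
  · intro m a _ hm
    obtain ⟨i, rfl⟩ : ∃ i, j = i + m := ⟨j - m, by omega⟩
    have hi := hD i (by omega)
    rw [D.leibniz, D.leibniz_pow, smul_eq_mul, smul_eq_mul, coeff_add, smul_eq_mul,
      coeff_X_pow_mul, hi.1, coeff_C_mul, coeff_smul]
    cases m with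
    | zero => simp
    | succ m =>
      rw [show i + (m + 1) = i + 1 + m by ring, Nat.add_sub_cancel, coeff_X_pow_mul, hi.2]
      simp
  · intro p q _ _ hp hq
    simp [hp, hq]

theorem RaisesDegreeLT.of_succ [IsDomain A] [CharZero A]
    (hrigid : ∀ D : Derivation k A A, IsLND D → D = 0) {D : Derivation k A[X] A[X]}
    (hD : IsLND D) {d : ℕ} (h : RaisesDegreeLT D (d + 1)) : RaisesDegreeLT D d := by
  set δ := coeffDerivation D d with hδ
  set f := (D X).coeff (d + 1) with hf
  set E := homogeneousDerivation δ f d with hE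
  have hEC : ∀ a, E (C a) = monomial d (δ a) := by
    intro a
    rw [hE, ← monomial_zero_left, homogeneousDerivation_monomial]
    simp
  have hEX : E X = monomial (d + 1) f := by
    rw [hE, X, homogeneousDerivation_monomial]
    simp [add_comm]
  have hR : RaisesDegreeLT (D - E) d := by
    intro j hj
    obtain rfl | hj := hj.eq_or_lt
    · simp [hEC, hEX, hδ, hf]
    · have := h j hj
      simp [hEC, hEX, coeff_monomial, hj.ne, this]
  have hmon : ∀ n a j, ∃ b, E^[j] (monomial n a) = monomial (n + j * d) b := by
    intro n a j
    induction j with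
    | zero => exact ⟨a, by simp⟩
    | succ j ih =>
      obtain ⟨b, hb⟩ := ih
      refine ⟨δ b + (n + j * d : ℕ) * f * b, ?_⟩
      rw [Function.iterate_succ_apply', hb, hE, homogeneousDerivation_monomial,
        show n + j * d + d = n + (j + 1) * d by ring]
  have hdiff : ∀ n a j i, n + j * d ≤ i →
      (D^[j] (monomial n a) - E^[j] (monomial n a)).coeff i = 0 := by
    intro n a j
    induction j with
    | zero => simp
    | succ j ih =>
      intro i hi
      rw [add_mul, one_mul, ← add_assoc] at hi
      obtain ⟨b, hb⟩ := hmon n a j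
      have h1 : (D (D^[j] (monomial n a) - E^[j] (monomial n a))).coeff i = 0 := by
        set q := D^[j] (monomial n a) - E^[j] (monomial n a)
        rcases hm : n + j * d with _ | m
        · have : q = 0 := by
            ext i
            exact ih i (by omega)
          simp [this]
        · refine h.coeff_eq_zero (n := m) (natDegree_le_iff_coeff_eq_zero.2 fun i hi => ?_) ?_
          · exact ih i (by omega)
          · omega
      have h2 : ((D - E) (E^[j] (monomial n a))).coeff i = 0 := by
        refine hR.coeff_eq_zero (n := n + j * d) ?_ hi
        rw [hb]
        exact natDegree_monomial_le _
      rw [Function.iterate_succ_apply', Function.iterate_succ_apply']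
      rw [map_sub, coeff_sub] at h1
      rw [Derivation.sub_apply, coeff_sub] at h2
      rw [coeff_sub]
      linear_combination h1 + h2
  have hElnd : IsLND E := by
    refine isLND_iff_iterate.2 fun p => ?_
    induction p using Polynomial.induction_on' with
    | add p q hp hq =>
      obtain ⟨n, hn⟩ := hp
      obtain ⟨m, hm⟩ := hq
      refine ⟨n + m, ?_⟩
      rw [iterate_map_add, Function.iterate_add_apply _ n m q, hm, add_comm n m,
        Function.iterate_add_apply, hn]
      simp
    | monomial n a =>
      obtain ⟨j, hj⟩ := isLND_iff_iterate.1 hD (monomial n a)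
      obtain ⟨b, hb⟩ := hmon n a j
      refine ⟨j, ?_⟩
      have := hdiff n a j _ le_rfl
      rw [hj, hb] at this
      rw [hb]
      simpa using this
  have hf0 : f = 0 := by
    have := hElnd.apply_eq_zero_of_dvd (a := X)
      ⟨monomial d f, by rw [hEX, X_mul_monomial]⟩
    rwa [hEX, monomial_eq_zero_iff] at this
  have hEj : ∀ a j, E^[j] (C a) = monomial (j * d) (δ^[j] a) := by
    intro a j
    induction j with
    | zero => simp
    | succ j ih =>
      rw [Function.iterate_succ_apply', ih, hE, homogeneousDerivation_monomial, hf0,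
        Function.iterate_succ_apply', add_mul, one_mul]
      simp
  have hδ0 : δ = 0 := by
    refine hrigid δ (isLND_iff_iterate.2 fun a => ?_)
    obtain ⟨j, hj⟩ := isLND_iff_iterate.1 hElnd (C a)
    rw [hEj, monomial_eq_zero_iff] at hj
    exact ⟨j, hj⟩
  intro j hj
  obtain rfl | hj := hj.eq_or_lt
  · exact ⟨fun a => DFunLike.congr_fun hδ0 a, hf0⟩
  · exact h j hj

theorem exists_raisesDegreeLT [IsDomain A] [CharZero A]
    (hft : ∃ s : Finset A, Algebra.IsAlgebraic (Algebra.adjoin k (s : Set A)) A)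
    (D : Derivation k A[X] A[X]) : ∃ d, RaisesDegreeLT D d := by
  obtain ⟨s, hs⟩ := hft
  refine ⟨(s.sup fun a => (D (C a)).natDegree) + (D X).natDegree + 1, fun j hj => ⟨?_, ?_⟩⟩
  · set S := Algebra.adjoin k (s : Set A)
    have hS : ∀ a ∈ S, coeffDerivation D j a = 0 := by
      intro a ha
      induction ha using Algebra.adjoin_induction with
      | mem a ha =>
        have := Finset.le_sup (f := fun a => (D (C a)).natDegree) ha
        rw [coeffDerivation_apply]
        exact coeff_eq_zero_of_natDegree_lt (by omega)
      | algebraMap r => exact Derivation.map_algebraMap _ r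
      | add a b _ _ ha hb => rw [map_add, ha, hb, add_zero]
      | mul a b _ _ ha hb => rw [Derivation.leibniz, ha, hb, smul_zero, smul_zero, add_zero]
    let D' : Derivation S A A := Derivation.mk'
      { toFun := coeffDerivation D j
        map_add' := map_add _
        map_smul' := fun c a => by
          rw [Algebra.smul_def, Derivation.leibniz, show algebraMap S A c = c from rfl, hS c c.2,
            smul_zero, add_zero]
          rfl }
      (coeffDerivation D j).leibniz
    intro a
    exact DFunLike.congr_fun D'.eq_zero_of_isAlgebraic a
  · exact coeff_eq_zero_of_natDegree_lt (by omega)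

theorem exists_eq_C_mul_derivative [IsDomain A] [CharZero A]
    (hft : ∃ s : Finset A, Algebra.IsAlgebraic (Algebra.adjoin k (s : Set A)) A)
    (hrigid : ∀ D : Derivation k A A, IsLND D → D = 0) {D : Derivation k A[X] A[X]}
    (hD : IsLND D) : ∃ f : A, ∀ p, D p = C f * derivative p := by
  have h0 : RaisesDegreeLT D 0 := by
    obtain ⟨d, hd⟩ := exists_raisesDegreeLT hft D
    induction d with
    | zero => exact hd
    | succ d ih => exact ih (hd.of_succ hrigid hD)
  have hC : ∀ a, D (C a) = 0 := fun a => by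
    ext j
    exact (h0 j (Nat.zero_le j)).1 a
  refine ⟨(D X).coeff 0, fun p => ?_⟩
  have hX : D X = C ((D X).coeff 0) :=
    eq_C_of_natDegree_le_zero <| natDegree_le_iff_coeff_eq_zero.2 fun i hi => by
      obtain ⟨j, rfl⟩ := Nat.exists_eq_add_of_lt hi
      simpa using (h0 j (Nat.zero_le j)).2
  rw [← hX]
  induction p using Polynomial.induction_on' with
  | add p q hp hq => rw [map_add, hp, hq, derivative_add, mul_add]
  | monomial n a =>
    rw [← C_mul_X_pow_eq_monomial, D.leibniz, hC, D.leibniz_pow, derivative_C_mul_X_pow]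
    simp only [smul_eq_mul, nsmul_eq_mul, map_mul, map_natCast]
    ring

theorem iterate_eq_zero_iff [IsDomain A] {D : Derivation k A[X] A[X]} {f : A}
    (hD : ∀ p, D p = C f * derivative p) (hne : D ≠ 0) (i : ℕ) (p : A[X]) :
    D^[i] p = 0 ↔ derivative^[i] p = 0 := by
  have hf : f ≠ 0 := by
    rintro rfl
    exact hne (Derivation.ext fun p => by simp [hD])
  have key : D^[i] p = C (f ^ i) * derivative^[i] p := by
    induction i with
    | zero => simp
    | succ i ih =>
      rw [Function.iterate_succ_apply', ih, hD, derivative_C_mul, Function.iterate_succ_apply',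
        pow_succ, C_mul]
      ring
  simp [key, hf]

end Polynomial

theorem stmt2 [Field k] [CharZero k] [CommRing A] [IsDomain A] [Algebra k A]
    -- `A` has finite transcendence degree over `k`
    (hft : ∃ s : Finset A, Algebra.IsAlgebraic (Algebra.adjoin k (s : Set A)) A)
    -- `A` is rigid
    (hrigid : ∀ D : Derivation k A A, IsLND D → D = 0) :
    SemiRigid k (Polynomial A) := by
  have : CharZero A := charZero_of_injective_algebraMap (FaithfulSMul.algebraMap_injective k A)
  intro D E hD hE hD0 hE0 i
  obtain ⟨f, hf⟩ := Polynomial.exists_eq_C_mul_derivative hft hrigid hD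
  obtain ⟨g, hg⟩ := Polynomial.exists_eq_C_mul_derivative hft hrigid hE
  ext p
  simp only [LinearMap.mem_ker, Module.End.pow_apply]
  exact (Polynomial.iterate_eq_zero_iff hf hD0 _ p).trans
    (Polynomial.iterate_eq_zero_iff hg hE0 _ p).symm
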